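/- Let A be a Heyting algebra with involution ∼ and let IC(A) = {a ∈ A : ¬a = ∼a} be its involutive center. Then ⊥ ∈ IC(A) and ⊤ ∈ IC(A); IC(A) is closed under ⊔, ⊓, and ¬; and every a ∈ IC(A) is complemented by ¬a, i.e., a ⊓ ¬a = ⊥ and a ⊔ ¬a = ⊤. In particular, for every a ∈ IC(A) one has ¬¬a = a, so IC(A) with the restricted operations is a Boolean algebra. -/

import Mathlib

section Involution

variable {A : Type*} [HeytingAlgebra A] {inv : A → A}

theorem involution_bot (hinv1 : ∀ a b : A, inv (a ⊔ b) = inv a ⊓ inv b)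
    (hinv2 : ∀ a : A, inv (inv a) = a) : inv ⊥ = ⊤ := by
  have h := hinv1 (inv ⊤) ⊥
  rw [sup_bot_eq, hinv2, top_inf_eq] at h
  exact h.symm

theorem involution_inf (hinv1 : ∀ a b : A, inv (a ⊔ b) = inv a ⊓ inv b)
    (hinv2 : ∀ a : A, inv (inv a) = a) (a b : A) : inv (a ⊓ b) = inv a ⊔ inv b := by
  rw [← hinv2 (inv a ⊔ inv b), hinv1, hinv2, hinv2]

theorem isCompl_compl_of_compl_eq_involution
    (hinv1 : ∀ a b : A, inv (a ⊔ b) = inv a ⊓ inv b)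
    (hinv2 : ∀ a : A, inv (inv a) = a) {a : A} (ha : aᶜ = inv a) : IsCompl a aᶜ := by
  refine IsCompl.of_eq (inf_compl_self a) ?_
  have h := involution_inf hinv1 hinv2 a aᶜ
  rw [inf_compl_self, involution_bot hinv1 hinv2, ha, hinv2, ← ha, sup_comm] at h
  exact h.symm

end Involution


/-- The involutive center `IC(A) = {a : ¬a = ∼a}` contains `⊥`, `⊤`, is closed
under `⊔`, `⊓`, `¬`, each of its elements is complemented by its
pseudocomplement, and `¬¬a = a` on it (so it is a Boolean algebra). -/
theorem stmt_7 {A : Type*} [HeytingAlgebra A] (inv : A → A)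
    (hinv1 : ∀ a b : A, inv (a ⊔ b) = inv a ⊓ inv b)
    (hinv2 : ∀ a : A, inv (inv a) = a) :
    (⊥ : A) ∈ {a : A | aᶜ = inv a} ∧ (⊤ : A) ∈ {a : A | aᶜ = inv a} ∧
    (∀ a b : A, a ∈ {a : A | aᶜ = inv a} → b ∈ {a : A | aᶜ = inv a} →
      a ⊔ b ∈ {a : A | aᶜ = inv a}) ∧
    (∀ a b : A, a ∈ {a : A | aᶜ = inv a} → b ∈ {a : A | aᶜ = inv a} →
      a ⊓ b ∈ {a : A | aᶜ = inv a}) ∧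
    (∀ a : A, a ∈ {a : A | aᶜ = inv a} → aᶜ ∈ {a : A | aᶜ = inv a}) ∧
    (∀ a : A, a ∈ {a : A | aᶜ = inv a} → a ⊓ aᶜ = ⊥ ∧ a ⊔ aᶜ = ⊤) ∧
    (∀ a : A, a ∈ {a : A | aᶜ = inv a} → aᶜᶜ = a) := by
  have hcompl : ∀ {a : A}, aᶜ = inv a → IsCompl a aᶜ :=
    isCompl_compl_of_compl_eq_involution hinv1 hinv2
  have hbot : inv ⊥ = ⊤ := involution_bot hinv1 hinv2
  simp only [Set.mem_ofPred_eq]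
  refine ⟨by rw [compl_bot, hbot], by rw [compl_top, ← hbot, hinv2], ?_, ?_, ?_, ?_, ?_⟩
  · intro a b ha hb
    rw [compl_sup, hinv1, ha, hb]
  · intro a b ha hb
    rw [((hcompl ha).inf_sup (hcompl hb)).compl_eq, involution_inf hinv1 hinv2, ha, hb]
  · intro a ha
    rw [(hcompl ha).symm.compl_eq, ha, hinv2]
  · exact fun a ha => ⟨inf_compl_self a, (hcompl ha).sup_eq_top⟩
  · exact fun a ha => (hcompl ha).symm.compl_eq
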